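/- Let n ≥ 1, let A and B be positive semidefinite Hermitian n×n complex matrices, and let 0 < s < 1 and γ ≥ 1 be real numbers. Then tr ((A^s − B^s)₊)^γ ≤ tr ((A − B)₊)^{sγ}, where for a Hermitian matrix M, M₊ denotes its positive part (obtained by replacing every negative eigenvalue by zero in the spectral decomposition), M^s for positive semidefinite M denotes the s-th power via the spectral functional calculus, and tr is the matrix trace. -/

import Mathlib

open Real
open scoped ComplexOrder

/-- The positive part of a Hermitian matrix, via the spectral functional calculus:
negative eigenvalues are replaced by zero. -/
noncomputable def matPosPart {n : ℕ} (M : Matrix (Fin n) (Fin n) ℂ) :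
    Matrix (Fin n) (Fin n) ℂ :=
  cfc (fun x : ℝ => max x 0) M

/-- The `s`-th power of a (positive semidefinite) matrix via the spectral
functional calculus. -/
noncomputable def matRpow {n : ℕ} (M : Matrix (Fin n) (Fin n) ℂ) (s : ℝ) :
    Matrix (Fin n) (Fin n) ℂ :=
  cfc (fun x : ℝ => x ^ s) M

section

open scoped MatrixOrder

/-- The quadratic form `y ↦ ⟪y, M y⟫` of a square matrix (its real part). -/
noncomputable def matQuadForm {n : ℕ} (M : Matrix (Fin n) (Fin n) ℂ)
    (y : EuclideanSpace ℂ (Fin n)) : ℝ :=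
  (inner ℂ y (M.toEuclideanLin y)).re

section QuadForm

variable {n : ℕ} {M N : Matrix (Fin n) (Fin n) ℂ}

lemma matQuadForm_add (M N : Matrix (Fin n) (Fin n) ℂ) (y : EuclideanSpace ℂ (Fin n)) :
    matQuadForm (M + N) y = matQuadForm M y + matQuadForm N y := by
  simp only [matQuadForm, map_add, LinearMap.add_apply, inner_add_right, Complex.add_re]

lemma matQuadForm_nonneg (hM : M.PosSemidef) (y : EuclideanSpace ℂ (Fin n)) :
    0 ≤ matQuadForm M y :=
  (Matrix.isPositive_toEuclideanLin_iff.2 hM).re_inner_nonneg_right y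

lemma matQuadForm_mono (h : M ≤ N) (y : EuclideanSpace ℂ (Fin n)) :
    matQuadForm M y ≤ matQuadForm N y := by
  have h1 := matQuadForm_add M (N - M) y
  have h2 := matQuadForm_nonneg (Matrix.le_iff.1 h) y
  rw [add_sub_cancel] at h1
  linarith

lemma matQuadForm_algebraMap (c : ℝ) (y : EuclideanSpace ℂ (Fin n)) :
    matQuadForm (algebraMap ℝ (Matrix (Fin n) (Fin n) ℂ) c) y = c * ‖y‖ ^ 2 := by
  have h : (algebraMap ℝ (Matrix (Fin n) (Fin n) ℂ) c) = (c : ℂ) • 1 := by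
    rw [Algebra.algebraMap_eq_smul_one]; ext i j; simp
  rw [matQuadForm, h, map_smul, LinearMap.smul_apply, inner_smul_right]
  have h2 : (1 : Matrix (Fin n) (Fin n) ℂ).toEuclideanLin y = y := by
    ext i; simp
  rw [h2, inner_self_eq_norm_sq_to_K, Complex.re_ofReal_mul]
  norm_cast

lemma toEuclideanLin_eigenvectorBasis (hM : M.IsHermitian) (i : Fin n) :
    M.toEuclideanLin (hM.eigenvectorBasis i) =
      (hM.eigenvalues i : ℂ) • hM.eigenvectorBasis i := by
  ext j
  have := congrFun (hM.mulVec_eigenvectorBasis i) j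
  simpa using this

lemma matQuadForm_eq_sum (hM : M.IsHermitian) (y : EuclideanSpace ℂ (Fin n)) :
    matQuadForm M y =
      ∑ i, hM.eigenvalues i * ‖inner ℂ (hM.eigenvectorBasis i) y‖ ^ 2 := by
  rw [matQuadForm, ← hM.eigenvectorBasis.sum_inner_mul_inner, Complex.re_sum]
  refine Finset.sum_congr rfl fun i _ => ?_
  rw [← (Matrix.isSymmetric_toEuclideanLin_iff.2 hM) (hM.eigenvectorBasis i) y,
    toEuclideanLin_eigenvectorBasis, inner_smul_left, Complex.conj_ofReal, mul_left_comm,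
    Complex.re_ofReal_mul, ← inner_conj_symm, mul_comm (starRingEnd ℂ _), Complex.mul_conj,
    Complex.normSq_eq_norm_sq, Complex.ofReal_re]

lemma matQuadForm_eigenvectorBasis (hM : M.IsHermitian) (i : Fin n) :
    matQuadForm M (hM.eigenvectorBasis i) = hM.eigenvalues i := by
  rw [matQuadForm, toEuclideanLin_eigenvectorBasis, inner_smul_right,
    inner_self_eq_norm_sq_to_K, hM.eigenvectorBasis.norm_eq_one]
  simp

lemma trace_re_eq_sum_matQuadForm (M : Matrix (Fin n) (Fin n) ℂ)
    (b : OrthonormalBasis (Fin n) ℂ (EuclideanSpace ℂ (Fin n))) :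
    M.trace.re = ∑ i, matQuadForm M (b i) := by
  have h : LinearMap.trace ℂ _ M.toEuclideanLin = M.trace := by
    rw [Matrix.toEuclideanLin, Matrix.toLpLin_eq_toLin, Matrix.trace_toLin_eq]
  rw [← h, LinearMap.trace_eq_sum_inner _ b, Complex.re_sum]
  rfl

lemma trace_cfc_re (hM : M.IsHermitian) (f : ℝ → ℝ) :
    (cfc f M).trace.re = ∑ i, f (hM.eigenvalues i) := by
  rw [hM.cfc_eq, Matrix.IsHermitian.cfc, Unitary.conjStarAlgAut_apply, Matrix.trace_mul_comm,
    ← mul_assoc, Unitary.coe_star_mul_self, one_mul, Matrix.trace_diagonal, Complex.re_sum]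
  rfl

lemma continuousOn_matrix_spectrum (M : Matrix (Fin n) (Fin n) ℂ) (f : ℝ → ℝ) :
    ContinuousOn f (spectrum ℝ M) :=
  M.finite_real_spectrum.continuousOn f

lemma cfc_cfc (hM : M.IsHermitian) (f g : ℝ → ℝ) :
    cfc g (cfc f M) = cfc (fun x => g (f x)) M :=
  (cfc_comp' g f M ((M.finite_real_spectrum.image f).continuousOn g)
    (continuousOn_matrix_spectrum M f) hM).symm

lemma trace_matRpow_matPosPart_re (hM : M.IsHermitian) (p : ℝ) :
    (matRpow (matPosPart M) p).trace.re = ∑ i, max (hM.eigenvalues i) 0 ^ p := by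
  rw [matRpow, matPosPart, cfc_cfc hM, trace_cfc_re hM]

end QuadForm

section Rotfeld

variable {n : ℕ}

lemma sum_mul_div_le_of_rankOne_le {X : Matrix (Fin n) (Fin n) ℂ} (hX : X.PosSemidef)
    {g : ℝ → ℝ} (hg : ConcaveOn ℝ (Set.Ici 0) g) (hg0 : g 0 = 0)
    {v : EuclideanSpace ℂ (Fin n)} (hv : ‖v‖ = 1) {b : ℝ} (hb : 0 ≤ b)
    (h : ∀ y, b * ‖inner ℂ v y‖ ^ 2 ≤ matQuadForm X y) :
    ∑ i, b * ‖inner ℂ v (hX.1.eigenvectorBasis i)‖ ^ 2 / hX.1.eigenvalues i *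
      g (hX.1.eigenvalues i) ≤ g b := by
  set e := hX.1.eigenvectorBasis
  set x := hX.1.eigenvalues
  have hx : ∀ i, 0 ≤ x i := hX.eigenvalues_nonneg
  set a : Fin n → ℝ := fun i => ‖inner ℂ v (e i)‖ ^ 2
  have ha : ∀ i, 0 ≤ a i := fun i => sq_nonneg _
  have hax : ∀ i, x i = 0 → b * a i = 0 := by
    intro i hi
    have := h (e i)
    rw [matQuadForm_eigenvectorBasis] at this
    exact le_antisymm (this.trans hi.le) (mul_nonneg hb (ha i))
  have hsum : ∑ i, a i = 1 := by
    have := e.sum_sq_norm_inner_left v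
    rw [hv] at this
    simpa [a] using this
  have ht : ∑ i, b * a i / x i ≤ 1 := by
    set t := ∑ i, a i / x i
    have ht0 : 0 ≤ t := Finset.sum_nonneg fun i _ => div_nonneg (ha i) (hx i)
    have hbt : ∑ i, b * a i / x i = b * t := by
      rw [Finset.mul_sum]; simp only [mul_div_assoc]
    rw [hbt]
    set y : EuclideanSpace ℂ (Fin n) := ∑ i, (inner ℂ (e i) v / (x i : ℂ)) • e i
    have hey : ∀ i, inner ℂ (e i) y = inner ℂ (e i) v / (x i : ℂ) := fun i =>
      e.orthonormal.inner_right_fintype _ i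
    have hvy : inner ℂ v y = (t : ℂ) := by
      simp only [y, inner_sum, inner_smul_right, t, Complex.ofReal_sum]
      refine Finset.sum_congr rfl fun i _ => ?_
      rw [← inner_conj_symm (e i) v, div_mul_eq_mul_div, mul_comm (starRingEnd ℂ _),
        Complex.mul_conj, Complex.normSq_eq_norm_sq]
      simp [a]
    have hXy : matQuadForm X y = t := by
      rw [matQuadForm_eq_sum hX.1]
      refine Finset.sum_congr rfl fun i _ => ?_
      change x i * ‖inner ℂ (e i) y‖ ^ 2 = a i / x i
      rw [hey, norm_div, norm_inner_symm, Complex.norm_real, Real.norm_of_nonneg (hx i), div_pow]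
      rcases eq_or_ne (x i) 0 with h0 | h0
      · simp [h0]
      · simp only [a]; field_simp
    have hy := h y
    rw [hvy, hXy, Complex.norm_real, Real.norm_of_nonneg ht0] at hy
    by_contra! hlt
    have htp : 0 < t := by
      rcases ht0.eq_or_lt with h0 | h0
      · rw [← h0] at hlt; simp at hlt; linarith
      · exact h0
    nlinarith
  have key := hg.map_add_sum_le (t := Finset.univ) (w := fun i => b * a i / x i) (p := x)
    (v := 1 - ∑ i, b * a i / x i) (q := 0)
    (fun i _ => div_nonneg (mul_nonneg hb (ha i)) (hx i)) (by ring)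
    (fun i _ => hx i) (by linarith) (by simp)
  have hb' : ∑ i, b * a i / x i * x i = b := by
    rw [Finset.sum_congr rfl fun i _ => div_mul_cancel_of_imp (hax i), ← Finset.mul_sum, hsum,
      mul_one]
  simp only [smul_eq_mul, hg0, mul_zero, zero_add, hb'] at key
  exact key

/-- Rotfel'd's trace inequality `tr g(B + E) ≤ tr g(B) + tr g(E)` for concave `g` vanishing
at `0`, in terms of eigenvalues. -/
lemma sum_concave_eigenvalues_add_le {B E : Matrix (Fin n) (Fin n) ℂ}
    (hB : B.PosSemidef) (hE : E.PosSemidef) {g : ℝ → ℝ}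
    (hg : ConcaveOn ℝ (Set.Ici 0) g) (hg0 : g 0 = 0) :
    ∑ i, g ((hB.add hE).1.eigenvalues i) ≤
      ∑ i, g (hB.1.eigenvalues i) + ∑ i, g (hE.1.eigenvalues i) := by
  have hX := hB.add hE
  have aux : ∀ {C : Matrix (Fin n) (Fin n) ℂ} (hC : C.PosSemidef),
      (∀ y, matQuadForm C y ≤ matQuadForm (B + E) y) →
      ∑ i, matQuadForm C (hX.1.eigenvectorBasis i) / hX.1.eigenvalues i *
        g (hX.1.eigenvalues i) ≤ ∑ i, g (hC.1.eigenvalues i) := by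
    intro C hC hCX
    simp_rw [matQuadForm_eq_sum hC.1, Finset.sum_div, Finset.sum_mul]
    rw [Finset.sum_comm]
    refine Finset.sum_le_sum fun j _ => ?_
    refine sum_mul_div_le_of_rankOne_le hX hg hg0 (hC.1.eigenvectorBasis.norm_eq_one j)
      (hC.eigenvalues_nonneg j) fun y => (le_trans ?_ (hCX y))
    rw [matQuadForm_eq_sum hC.1]
    exact Finset.single_le_sum
      (f := fun j => hC.1.eigenvalues j * ‖inner ℂ (hC.1.eigenvectorBasis j) y‖ ^ 2)
      (fun k _ => mul_nonneg (hC.eigenvalues_nonneg k) (sq_nonneg _)) (Finset.mem_univ j)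
  refine le_trans (le_of_eq ?_) (add_le_add
    (aux hB fun y => by linarith [matQuadForm_add B E y, matQuadForm_nonneg hE y])
    (aux hE fun y => by linarith [matQuadForm_add B E y, matQuadForm_nonneg hB y]))
  rw [← Finset.sum_add_distrib]
  refine Finset.sum_congr rfl fun i _ => ?_
  rw [← add_mul, ← add_div, ← matQuadForm_add, matQuadForm_eigenvectorBasis]
  rcases eq_or_ne (hX.1.eigenvalues i) 0 with h0 | h0
  · simp [h0, hg0]
  · rw [div_self h0, one_mul]

end Rotfeld

section WeakMajorization

open intervalIntegral MeasureTheory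

lemma intervalIntegrable_hinge_mul_rpow (x a b : ℝ) {γ : ℝ} (hγ : 1 < γ) :
    IntervalIntegrable (fun t => max (x - t) 0 * t ^ (γ - 2)) volume a b :=
  (intervalIntegrable_rpow' (by linarith)).continuousOn_mul (by fun_prop)

lemma integral_hinge_mul_rpow {x M γ : ℝ} (hxM : x ≤ M) (hM : 0 ≤ M) (hγ : 1 < γ) :
    ∫ t in (0 : ℝ)..M, max (x - t) 0 * t ^ (γ - 2) = max x 0 ^ γ / (γ * (γ - 1)) := by
  set y := max x 0 with hy
  have hy0 : 0 ≤ y := le_max_right _ _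
  have hyM : y ≤ M := max_le hxM hM
  have hγ0 : γ ≠ 0 := by linarith
  have hγ1 : γ - 1 ≠ 0 := by linarith
  rw [← integral_add_adjacent_intervals (intervalIntegrable_hinge_mul_rpow x 0 y hγ)
    (intervalIntegrable_hinge_mul_rpow x y M hγ)]
  have h2 : ∫ t in y..M, max (x - t) 0 * t ^ (γ - 2) = 0 := by
    rw [integral_congr (g := fun _ => 0)]
    · simp
    · intro t ht
      rw [Set.uIcc_of_le hyM] at ht
      have : x ≤ t := (le_max_left _ _).trans ht.1
      simp [max_eq_right (sub_nonpos.2 this)]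
  have h1 : ∫ t in (0 : ℝ)..y, max (x - t) 0 * t ^ (γ - 2) =
      ∫ t in (0 : ℝ)..y, (y * t ^ (γ - 2) - t ^ (γ - 1)) := by
    refine integral_congr_ae (Filter.Eventually.of_forall fun t ht => ?_)
    rw [Set.uIoc_of_le hy0] at ht
    have hyx : y = x := by
      rw [hy]
      refine max_eq_left (le_of_not_ge fun h => ?_)
      rw [hy, max_eq_right h] at ht
      linarith [ht.1, ht.2]
    have hp : t ^ (γ - 1) = t * t ^ (γ - 2) := by
      rw [show γ - 1 = 1 + (γ - 2) by ring, Real.rpow_add ht.1, Real.rpow_one]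
    rw [max_eq_left (by linarith [ht.2]), hp, hyx]
    ring
  rw [h1, h2, intervalIntegral.integral_sub, intervalIntegral.integral_const_mul, integral_rpow (Or.inl (by linarith)),
    integral_rpow (Or.inl (by linarith))]
  · have hp : y ^ γ = y * y ^ (γ - 1) := by
      rcases hy0.eq_or_lt with h0 | h0
      · rw [← h0, Real.zero_rpow hγ0, zero_mul]
      · rw [← Real.rpow_one_add' hy0 (by linarith)]; congr 1; ring
    rw [show γ - 2 + 1 = γ - 1 by ring, show γ - 1 + 1 = γ by ring, Real.zero_rpow hγ0,
      Real.zero_rpow hγ1, hp]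
    field_simp
    ring
  · exact (intervalIntegrable_rpow' (by linarith)).const_mul _
  · exact intervalIntegrable_rpow' (by linarith)

/-- Weak submajorization, tested on the functions `x ↦ (x - t)₊` with `t ≥ 0`, implies the
inequality for `x ↦ (x₊)^γ` with `γ ≥ 1`. -/
lemma sum_rpow_le_of_sum_hinge_le {ι : Type*} [Fintype ι] {d e : ι → ℝ} {γ : ℝ} (hγ : 1 ≤ γ)
    (h : ∀ t, 0 ≤ t → ∑ i, max (d i - t) 0 ≤ ∑ i, max (e i - t) 0) :
    ∑ i, max (d i) 0 ^ γ ≤ ∑ i, max (e i) 0 ^ γ := by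
  rcases hγ.eq_or_lt with rfl | hγ
  · simpa using h 0 le_rfl
  set M : ℝ := ∑ i, (|d i| + |e i|)
  have hM : ∀ i, |d i| + |e i| ≤ M := fun i =>
    Finset.single_le_sum (f := fun i => |d i| + |e i|) (fun i _ => by positivity)
      (Finset.mem_univ i)
  have hM0 : 0 ≤ M := Finset.sum_nonneg fun i _ => by positivity
  have hpos : 0 < γ * (γ - 1) := by nlinarith
  have hinge_eq : ∀ f : ι → ℝ, (∀ i, f i ≤ M) → ∑ i, max (f i) 0 ^ γ =
      (γ * (γ - 1)) * ∫ t in (0 : ℝ)..M, (∑ i, max (f i - t) 0) * t ^ (γ - 2) := by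
    intro f hf
    simp_rw [Finset.sum_mul]
    rw [integral_finsetSum fun i _ => intervalIntegrable_hinge_mul_rpow (f i) 0 M hγ,
      Finset.mul_sum]
    refine Finset.sum_congr rfl fun i _ => ?_
    rw [integral_hinge_mul_rpow (hf i) hM0 hγ]
    field_simp
  have hi : ∀ f : ι → ℝ, IntervalIntegrable (fun t => (∑ i, max (f i - t) 0) * t ^ (γ - 2))
      volume 0 M := fun f =>
    (intervalIntegrable_rpow' (by linarith)).continuousOn_mul (by fun_prop)
  rw [hinge_eq d fun i => by linarith [hM i, le_abs_self (d i), abs_nonneg (e i)],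
    hinge_eq e fun i => by linarith [hM i, le_abs_self (e i), abs_nonneg (d i)]]
  refine mul_le_mul_of_nonneg_left (integral_mono_on hM0 (hi d) (hi e) fun t ht => ?_) hpos.le
  exact mul_le_mul_of_nonneg_right (h t ht.1) (Real.rpow_nonneg ht.1 _)

end WeakMajorization

section BKS

variable {n : ℕ} {A B : Matrix (Fin n) (Fin n) ℂ}

open scoped Matrix.Norms.L2Operator in
lemma matRpow_mono {s : ℝ} (hs0 : 0 ≤ s) (hs1 : s ≤ 1) (hA : A.PosSemidef) (hAB : A ≤ B) :
    matRpow A s ≤ matRpow B s := by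
  have hA' : 0 ≤ A := Matrix.nonneg_iff_posSemidef.2 hA
  have h := CFC.rpow_le_rpow (p := s) ⟨hs0, hs1⟩ hAB
  rwa [CFC.rpow_eq_cfc_real hA', CFC.rpow_eq_cfc_real (hA'.trans hAB)] at h

lemma cfc_mono_of_spectrum {M : Matrix (Fin n) (Fin n) ℂ} {f g : ℝ → ℝ}
    (h : ∀ x ∈ spectrum ℝ M, f x ≤ g x) : cfc f M ≤ cfc g M :=
  cfc_mono h (continuousOn_matrix_spectrum M f) (continuousOn_matrix_spectrum M g)

lemma posSemidef_cfc {M : Matrix (Fin n) (Fin n) ℂ} {f : ℝ → ℝ}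
    (h : ∀ x ∈ spectrum ℝ M, 0 ≤ f x) : (cfc f M).PosSemidef :=
  Matrix.nonneg_iff_posSemidef.1 (cfc_nonneg h)

lemma cfc_add_const_eq {M : Matrix (Fin n) (Fin n) ℂ} (hM : M.IsHermitian) (f : ℝ → ℝ) (c : ℝ) :
    cfc (fun x => f x + c) M = cfc f M + algebraMap ℝ _ c :=
  cfc_add_const c f M (continuousOn_matrix_spectrum M f) hM

lemma sum_hinge_eigenvalues_le {D F : Matrix (Fin n) (Fin n) ℂ} (hD : D.IsHermitian)
    (hF : F.PosSemidef) {t : ℝ} (h : D ≤ F + algebraMap ℝ _ t) :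
    ∑ i, max (hD.eigenvalues i - t) 0 ≤ F.trace.re := by
  rw [trace_re_eq_sum_matQuadForm F hD.eigenvectorBasis]
  refine Finset.sum_le_sum fun i _ => max_le ?_ (matQuadForm_nonneg hF _)
  have := matQuadForm_mono h (hD.eigenvectorBasis i)
  rw [matQuadForm_eigenvectorBasis, matQuadForm_add, matQuadForm_algebraMap,
    hD.eigenvectorBasis.norm_eq_one] at this
  linarith

lemma concaveOn_add_rpow_sub {s c : ℝ} (hs0 : 0 ≤ s) (hs1 : s ≤ 1) (hc : 0 ≤ c) :
    ConcaveOn ℝ (Set.Ici 0) fun x : ℝ => (x + c) ^ s - c ^ s := by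
  have h := ((Real.concaveOn_rpow hs0 hs1).translate_left c).subset
    (fun x (hx : x ∈ Set.Ici 0) => add_nonneg hc hx) (convex_Ici 0)
  exact h.sub (convexOn_const (c ^ s) (convex_Ici 0))

/-- The trace form of Rotfel'd's inequality for `x ↦ (x + c)^s`. -/
lemma trace_cfc_add_rpow_sub_le {B E : Matrix (Fin n) (Fin n) ℂ} (hB : B.PosSemidef)
    (hE : E.PosSemidef) {s c : ℝ} (hs0 : 0 ≤ s) (hs1 : s ≤ 1) (hc : 0 ≤ c) :
    (cfc (fun x : ℝ => (x + c) ^ s) (B + E) - cfc (fun x : ℝ => (x + c) ^ s) B).trace.re ≤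
      ∑ i, ((hE.1.eigenvalues i + c) ^ s - c ^ s) := by
  have h := sum_concave_eigenvalues_add_le hB hE (concaveOn_add_rpow_sub hs0 hs1 hc) (by simp)
  rw [Matrix.trace_sub, Complex.sub_re, trace_cfc_re (hB.add hE).1, trace_cfc_re hB.1]
  simp only [Finset.sum_sub_distrib] at h ⊢
  linarith

lemma sum_hinge_eigenvalues_rpow_sub_le (hA : A.PosSemidef) (hB : B.PosSemidef)
    {s : ℝ} (hs0 : 0 < s) (hs1 : s ≤ 1) (hD : (matRpow A s - matRpow B s).IsHermitian)
    {t : ℝ} (ht : 0 ≤ t) :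
    ∑ i, max (hD.eigenvalues i - t) 0 ≤
      ∑ i, max (max ((hA.1.sub hB.1).eigenvalues i) 0 ^ s - t) 0 := by
  obtain ⟨c, hc, rfl⟩ : ∃ c : ℝ, 0 ≤ c ∧ c ^ s = t :=
    ⟨t ^ s⁻¹, Real.rpow_nonneg ht _, Real.rpow_inv_rpow ht hs0.ne'⟩
  have hAB := hA.1.sub hB.1
  set E := cfc (fun x : ℝ => max (x - c) 0) (A - B) with hEdef
  have hE : E.PosSemidef := posSemidef_cfc fun _ _ => le_max_right _ _
  have hX : (B + E).PosSemidef := hB.add hE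
  have hshift : ∀ {M : Matrix (Fin n) (Fin n) ℂ} (hM : M.IsHermitian),
      matRpow (M + algebraMap ℝ _ c) s = cfc (fun x : ℝ => (x + c) ^ s) M := by
    intro M hM
    have hid : cfc (fun x : ℝ => x) M = M := cfc_id' ℝ M hM
    have h : cfc (fun x : ℝ => x + c) M = M + algebraMap ℝ _ c := by
      rw [cfc_add_const_eq hM, hid]
    rw [← h, matRpow, cfc_cfc hM]
  have hle : A - B ≤ E + algebraMap ℝ _ c := by
    rw [hEdef, ← cfc_add_const_eq hAB]
    conv_lhs => rw [← cfc_id' ℝ (A - B) hAB]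
    refine cfc_mono_of_spectrum fun x _ => ?_
    linarith [le_max_left (x - c) 0]
  have hAle : A ≤ B + E + algebraMap ℝ _ c := by
    rw [add_assoc]
    exact sub_le_iff_le_add'.1 hle
  have h1 : matRpow A s ≤ cfc (fun x : ℝ => (x + c) ^ s) (B + E) := by
    rw [← hshift hX.1]
    exact matRpow_mono hs0.le hs1 hA hAle
  have h2 : cfc (fun x : ℝ => (x + c) ^ s) B ≤ matRpow B s + algebraMap ℝ _ (c ^ s) := by
    rw [matRpow, ← cfc_add_const_eq hB.1]
    refine cfc_mono_of_spectrum fun x hx => Real.rpow_add_le_add_rpow ?_ hc hs0.le hs1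
    exact spectrum_nonneg_of_nonneg (Matrix.nonneg_iff_posSemidef.2 hB) hx
  have hc0 : (0 : Matrix (Fin n) (Fin n) ℂ) ≤ algebraMap ℝ _ c := algebraMap_nonneg _ hc
  have h3 : cfc (fun x : ℝ => (x + c) ^ s) B ≤ cfc (fun x : ℝ => (x + c) ^ s) (B + E) := by
    rw [← hshift hX.1, ← hshift hB.1]
    refine matRpow_mono hs0.le hs1 (hB.add (Matrix.nonneg_iff_posSemidef.1 hc0)) ?_
    exact add_le_add_left (le_add_of_nonneg_right (Matrix.nonneg_iff_posSemidef.2 hE)) _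
  refine (sum_hinge_eigenvalues_le hD (Matrix.le_iff.1 h3) ?_).trans
    ((trace_cfc_add_rpow_sub_le hB hE hs0.le hs1 hc).trans (le_of_eq ?_))
  · calc matRpow A s - matRpow B s
        ≤ cfc (fun x : ℝ => (x + c) ^ s) (B + E) -
          (cfc (fun x : ℝ => (x + c) ^ s) B - algebraMap ℝ _ (c ^ s)) :=
          sub_le_sub h1 (sub_le_iff_le_add.2 h2)
      _ = _ := by abel
  · rw [← trace_cfc_re hE.1 (fun x => (x + c) ^ s - c ^ s), hEdef, cfc_cfc hAB,
      trace_cfc_re hAB]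
    refine Finset.sum_congr rfl fun i _ => ?_
    set x := hAB.eigenvalues i
    have hx : max (x - c) 0 + c = max x c := by rw [max_add]; simp
    rw [hx]
    rcases le_total x c with h | h
    · rw [max_eq_right h, sub_self, max_eq_right]
      exact sub_nonpos.2 (Real.rpow_le_rpow (le_max_right _ _) (max_le h hc) hs0.le)
    · rw [max_eq_left h, max_eq_left (hc.trans h), max_eq_left]
      exact sub_nonneg.2 (Real.rpow_le_rpow hc h hs0.le)

end BKS

end

/-- The Birman–Koplienko–Solomyak inequality for positive semidefinite matrices:
`tr ((A^s − B^s)₊)^γ ≤ tr ((A − B)₊)^{sγ}` for `0 < s < 1` and `γ ≥ 1`. -/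
theorem bks_inequality {n : ℕ} (hn : 1 ≤ n)
    (A B : Matrix (Fin n) (Fin n) ℂ) (hA : A.PosSemidef) (hB : B.PosSemidef)
    (s γ : ℝ) (hs0 : 0 < s) (hs1 : s < 1) (hγ : 1 ≤ γ) :
    (Matrix.trace (matRpow (matPosPart (matRpow A s - matRpow B s)) γ)).re
      ≤ (Matrix.trace (matRpow (matPosPart (A - B)) (s * γ))).re := by
  have hD : (matRpow A s - matRpow B s).IsHermitian :=
    Matrix.IsHermitian.sub (cfc_predicate _ A) (cfc_predicate _ B)
  have hAB := hA.1.sub hB.1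
  rw [trace_matRpow_matPosPart_re hD, trace_matRpow_matPosPart_re hAB]
  refine (sum_rpow_le_of_sum_hinge_le hγ fun t ht =>
    sum_hinge_eigenvalues_rpow_sub_le hA hB hs0 hs1.le hD ht).trans (le_of_eq ?_)
  refine Finset.sum_congr rfl fun i _ => ?_
  have h0 : (0 : ℝ) ≤ max (hAB.eigenvalues i) 0 := le_max_right _ _
  rw [max_eq_left (Real.rpow_nonneg h0 s), ← Real.rpow_mul h0]
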